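/- Upper capacity entropy inequality for factor maps: Let G be a countable infinite discrete amenable group and π : (X,G) → (Y,G) a factor map between two G-action topological dynamical systems. Let {F_n} be a tempered Følner sequence in G satisfying the growth condition. Then for any subset E of X, h^{UC}_top(E,{F_n}) ≤ h^{UC}_top(π(E),{F_n}) + sup_{y∈Y} h^{UC}_top(π⁻¹(y),{F_n}). -/

import Mathlib

open Filter Set MeasureTheory ENNReal Topology
open scoped Pointwise symmDiff NNReal

namespace AmenablePacking

variable {G X Y : Type*}

/-- The open dynamical (Bowen) ball of center `x` and radius `ε` over the finite set `F`. -/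
def dynBall [PseudoMetricSpace X] (act : G → X → X) (F : Finset G) (x : X) (ε : ℝ) : Set X :=
  {y | ∀ g ∈ F, dist (act g x) (act g y) < ε}

/-- The closed dynamical (Bowen) ball of center `x` and radius `ε` over the finite set `F`. -/
def dynClosedBall [PseudoMetricSpace X] (act : G → X → X) (F : Finset G) (x : X) (ε : ℝ) :
    Set X :=
  {y | ∀ g ∈ F, dist (act g x) (act g y) ≤ ε}

/-- The packing pre-measure `P(Z, N, ε, s, {F_n})`: the supremum of `∑ᵢ exp (- s |F_{n_i}|)` over
all finite or countable pairwise disjoint families of closed Bowen balls with centers in `Z`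
and indices `n_i ≥ N`. -/
noncomputable def packP [PseudoMetricSpace X] (act : G → X → X) (Fs : ℕ → Finset G) (Z : Set X)
    (N : ℕ) (ε s : ℝ) : ℝ≥0∞ :=
  ⨆ (t : Set ℕ) (c : ℕ → X × ℕ) (_ : ∀ i ∈ t, (c i).1 ∈ Z ∧ N ≤ (c i).2)
    (_ : ∀ i ∈ t, ∀ j ∈ t, i ≠ j →
      Disjoint (dynClosedBall act (Fs (c i).2) (c i).1 ε)
        (dynClosedBall act (Fs (c j).2) (c j).1 ε)),
    ∑' i : t, ENNReal.ofReal (Real.exp (-s * ((Fs (c (i : ℕ)).2).card : ℝ)))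

/-- `P(Z, ε, s, {F_n}) = lim_{N → ∞} P(Z, N, ε, s, {F_n})`; the quantity is non-increasing
in `N`, so the limit equals the infimum. -/
noncomputable def packPLim [PseudoMetricSpace X] (act : G → X → X) (Fs : ℕ → Finset G)
    (Z : Set X) (ε s : ℝ) : ℝ≥0∞ :=
  ⨅ N : ℕ, packP act Fs Z N ε s

/-- `𝒫(Z, ε, s, {F_n})`: the countably subadditive envelope of `P(·, ε, s, {F_n})`. -/
noncomputable def packOuter [PseudoMetricSpace X] (act : G → X → X) (Fs : ℕ → Finset G)
    (Z : Set X) (ε s : ℝ) : ℝ≥0∞ :=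
  ⨅ (Zs : ℕ → Set X) (_ : Z ⊆ ⋃ i, Zs i), ∑' i, packPLim act Fs (Zs i) ε s

/-- `h^P_top(Z, ε, {F_n})`: the critical value of `s ≥ 0` at which `𝒫(Z, ε, s, {F_n})` jumps
from `+∞` to `0`. -/
noncomputable def packEntEps [PseudoMetricSpace X] (act : G → X → X) (Fs : ℕ → Finset G)
    (Z : Set X) (ε : ℝ) : ℝ≥0∞ :=
  ⨅ (s : ℝ≥0) (_ : packOuter act Fs Z ε (s : ℝ) = 0), (s : ℝ≥0∞)

/-- The amenable packing topological entropy
`h^P_top(Z, {F_n}) = lim_{ε → 0} h^P_top(Z, ε, {F_n})`. -/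
noncomputable def packEnt [PseudoMetricSpace X] (act : G → X → X) (Fs : ℕ → Finset G)
    (Z : Set X) : ℝ≥0∞ :=
  ⨆ (ε : ℝ) (_ : 0 < ε), packEntEps act Fs Z ε

/-- The Bowen pre-measure `ℳ(Z, N, ε, s, {F_n})`: the infimum of `∑ᵢ exp (- s |F_{n_i}|)` over
all finite or countable families of open Bowen balls with indices `n_i ≥ N` covering `Z`. -/
noncomputable def bowenM [PseudoMetricSpace X] (act : G → X → X) (Fs : ℕ → Finset G) (Z : Set X)
    (N : ℕ) (ε s : ℝ) : ℝ≥0∞ :=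
  ⨅ (t : Set ℕ) (c : ℕ → X × ℕ) (_ : ∀ i ∈ t, N ≤ (c i).2)
    (_ : Z ⊆ ⋃ i ∈ t, dynBall act (Fs (c i).2) (c i).1 ε),
    ∑' i : t, ENNReal.ofReal (Real.exp (-s * ((Fs (c (i : ℕ)).2).card : ℝ)))

/-- `ℳ(Z, s, {F_n}) = lim_{ε → 0} lim_{N → ∞} ℳ(Z, N, ε, s, {F_n})`. -/
noncomputable def bowenMLim [PseudoMetricSpace X] (act : G → X → X) (Fs : ℕ → Finset G)
    (Z : Set X) (s : ℝ) : ℝ≥0∞ :=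
  ⨆ (ε : ℝ) (_ : 0 < ε), ⨆ N : ℕ, bowenM act Fs Z N ε s

/-- The amenable Bowen topological entropy `h^B_top(Z, {F_n})`: the critical value of `s ≥ 0`
at which `ℳ(Z, s, {F_n})` jumps from `+∞` to `0`. -/
noncomputable def bowenEnt [PseudoMetricSpace X] (act : G → X → X) (Fs : ℕ → Finset G)
    (Z : Set X) : ℝ≥0∞ :=
  ⨅ (s : ℝ≥0) (_ : bowenMLim act Fs Z (s : ℝ) = 0), (s : ℝ≥0∞)

/-- `E` is an `(F, ε)`-separated set: distinct points are at `d_F`-distance `> ε`. -/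
def IsDynSeparated [PseudoMetricSpace X] (act : G → X → X) (F : Finset G) (ε : ℝ)
    (E : Set X) : Prop :=
  ∀ x ∈ E, ∀ y ∈ E, x ≠ y → ∃ g ∈ F, ε < dist (act g x) (act g y)

/-- `s_F(Z, ε)`: the maximal cardinality of an `(F, ε)`-separated subset of `Z`. -/
noncomputable def sepNum [PseudoMetricSpace X] (act : G → X → X) (F : Finset G) (Z : Set X)
    (ε : ℝ) : ℕ :=
  sSup {k : ℕ | ∃ E : Finset X, ↑E ⊆ Z ∧ IsDynSeparated act F ε ↑E ∧ E.card = k}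

/-- The upper capacity entropy of `Z` at scale `ε`:
`limsup_n (1/|F_n|) log s_{F_n}(Z, ε)`. -/
noncomputable def ucEntEps [PseudoMetricSpace X] (act : G → X → X) (Fs : ℕ → Finset G)
    (Z : Set X) (ε : ℝ) : ℝ≥0∞ :=
  limsup (fun n => ENNReal.ofReal (Real.log ((sepNum act (Fs n) Z ε : ℝ)) / ((Fs n).card : ℝ)))
    atTop

/-- The upper capacity topological entropy `h^{UC}_top(Z, {F_n})`. -/
noncomputable def ucEnt [PseudoMetricSpace X] (act : G → X → X) (Fs : ℕ → Finset G)
    (Z : Set X) : ℝ≥0∞ :=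
  ⨆ (ε : ℝ) (_ : 0 < ε), ucEntEps act Fs Z ε

/-- The upper local entropy `h̄^loc_μ(Z, {F_n}) =
`∫_Z lim_{ε→0} limsup_n -(1/|F_n|) log μ(B_{F_n}(x, ε)) dμ`. -/
noncomputable def upperLocalEnt [PseudoMetricSpace X] [MeasurableSpace X] (act : G → X → X)
    (Fs : ℕ → Finset G) (μ : Measure X) (Z : Set X) : ℝ≥0∞ :=
  ∫⁻ x in Z, ⨆ (ε : ℝ) (_ : 0 < ε),
    limsup (fun n =>
      ENNReal.ofReal (-Real.log ((μ (dynBall act (Fs n) x ε)).toReal) / ((Fs n).card : ℝ)))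
      atTop ∂μ

/-- A Følner sequence: a sequence of nonempty finite subsets of `G` which is asymptotically
invariant, i.e. `|g F_n ∆ F_n| / |F_n| → 0` for every `g ∈ G`. -/
def Folner [Group G] [DecidableEq G] (Fs : ℕ → Finset G) : Prop :=
  (∀ n, (Fs n).Nonempty) ∧
    ∀ g : G,
      Tendsto (fun n => ((((Fs n).image fun h => g * h) ∆ Fs n).card : ℝ) / ((Fs n).card : ℝ))
        atTop (nhds 0)

/-- A tempered sequence: `|⋃_{k < n} F_k⁻¹ F_n| ≤ C |F_n|` for a constant `C > 0`. -/
def Tempered [Group G] [DecidableEq G] (Fs : ℕ → Finset G) : Prop :=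
  ∃ C : ℝ, 0 < C ∧
    ∀ n : ℕ, ((((Finset.range n).biUnion fun k => (Fs k)⁻¹ * Fs n).card : ℝ))
      ≤ C * ((Fs n).card : ℝ)

/-- The growth condition `lim_n |F_n| / log n = +∞`. -/
def GrowthCond (Fs : ℕ → Finset G) [Group G] : Prop :=
  Tendsto (fun n => ((Fs n).card : ℝ) / Real.log (n : ℝ)) atTop atTop

/-- The static (Shannon) entropy of the finite measurable partition of `X` induced by a map
into a finite set. -/
noncomputable def partEnt [MeasurableSpace X] (μ : Measure X) {ι : Type*} [Fintype ι]
    (P : X → ι) : ℝ :=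
  ∑ i : ι, Real.negMulLog ((μ (P ⁻¹' {i})).toReal)

/-- The measure-theoretic (Kolmogorov–Sinai) entropy `h_μ(X, G)` of the action w.r.t. the
invariant measure `μ`, computed along the Følner sequence `{F_n}`: the supremum over finite
measurable partitions `P` of `lim_n (1/|F_n|) H_μ(⋁_{g ∈ F_n} (act g)⁻¹ P)`. -/
noncomputable def measEnt [MeasurableSpace X] [DecidableEq G] (act : G → X → X)
    (Fs : ℕ → Finset G) (μ : Measure X) : ℝ≥0∞ :=
  ⨆ (k : ℕ) (P : X → Fin k) (_ : Measurable P),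
    limsup (fun n => ENNReal.ofReal
      ((partEnt μ fun x (g : (Fs n : Finset G)) => P (act (g : G) x)) / ((Fs n).card : ℝ)))
      atTop

/-- The set of generic points of `μ` w.r.t. `{F_n}`. -/
def genericPoints [TopologicalSpace X] [MeasurableSpace X] (act : G → X → X)
    (Fs : ℕ → Finset G) (μ : Measure X) : Set X :=
  {x | ∀ f : C(X, ℝ),
    Tendsto (fun n => (∑ g ∈ Fs n, f (act g x)) / ((Fs n).card : ℝ)) atTop
      (nhds (∫ y, f y ∂μ))}

/-- `μ` is invariant under the action. -/
def InvariantMeasure [MeasurableSpace X] (act : G → X → X) (μ : Measure X) : Prop :=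
  ∀ (g : G) (s : Set X), MeasurableSet s → μ (act g ⁻¹' s) = μ s

/-- The action is ergodic w.r.t. `μ`: every invariant measurable set is null or conull. -/
def ErgodicAction [MeasurableSpace X] (act : G → X → X) (μ : Measure X) : Prop :=
  ∀ s : Set X, MeasurableSet s → (∀ g : G, act g ⁻¹' s = s) → μ s = 0 ∨ μ s = 1

theorem card_image_mul_right [Group G] [DecidableEq G] (F : Finset G) (c : G) :
    (F.image (· * c)).card = F.card :=
  Finset.card_image_of_injective _ (mul_left_injective c)

/-- Double counting: the translates `F c`, `c ∈ A`, meet a set `S` in at most `|F| |S|` points,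
counted with multiplicity. -/
theorem sum_card_image_mul_inter_le [Group G] [DecidableEq G] (A F S : Finset G) :
    ∑ c ∈ A, (F.image (· * c) ∩ S).card ≤ F.card * S.card := by
  calc ∑ c ∈ A, (F.image (· * c) ∩ S).card
      ≤ ∑ c ∈ A, (F.filter fun h => h * c ∈ S).card := by
        refine Finset.sum_le_sum fun c _ => ?_
        refine le_trans (Finset.card_le_card ?_)
          (Finset.card_image_le (f := (· * c)) (s := F.filter fun h => h * c ∈ S))
        intro x hx
        simp only [Finset.mem_inter, Finset.mem_image, Finset.mem_filter] at hx ⊢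
        obtain ⟨⟨h, hh, rfl⟩, hS⟩ := hx
        exact ⟨h, ⟨hh, hS⟩, rfl⟩
    _ = ∑ h ∈ F, (A.filter fun c => h * c ∈ S).card :=
        Finset.sum_card_bipartiteAbove_eq_sum_card_bipartiteBelow (fun c h => h * c ∈ S)
    _ ≤ ∑ _h ∈ F, S.card := by
        refine Finset.sum_le_sum fun h _ => ?_
        refine Finset.card_le_card_of_injOn (h * ·) ?_ (mul_right_injective h).injOn
        intro c hc
        simpa using (Finset.mem_filter.1 hc).2
    _ = F.card * S.card := by simp

/-- Greedy selection, in order of decreasing index, of an almost disjoint subfamily of translates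
such that every translate of the family is met substantially by the selected translates of at
least the same index. -/
theorem exists_greedy_translates [Group G] [DecidableEq G] (Fs : ℕ → Finset G) {ε : ℝ}
    (hε1 : ε < 1) (m : G → ℕ) (A : Finset G) :
    ∃ B ⊆ A,
      (1 - ε) * ∑ c ∈ B, ((Fs (m c)).card : ℝ)
        ≤ ((B.biUnion fun c => (Fs (m c)).image (· * c)).card : ℝ) ∧
      ∀ c ∈ A, ε * ((Fs (m c)).card : ℝ) ≤
        (((Fs (m c)).image (· * c) ∩
          (B.filter fun c' => m c ≤ m c').biUnion fun c' => (Fs (m c')).image (· * c')).card : ℝ) := by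
  induction A using Finset.induction_on_min_value m with
  | empty => exact ⟨∅, by simp⟩
  | insert a s has hmin ih =>
    obtain ⟨B, hB, hdisj, hmeet⟩ := ih
    by_cases h : ε * ((Fs (m a)).card : ℝ) ≤
        (((Fs (m a)).image (· * a) ∩
          B.biUnion fun c' => (Fs (m c')).image (· * c')).card : ℝ)
    · refine ⟨B, hB.trans (Finset.subset_insert _ _), hdisj, fun c hc => ?_⟩
      rcases Finset.mem_insert.1 hc with rfl | hc
      · rwa [Finset.filter_true_of_mem fun c' hc' => hmin c' (hB hc')]
      · exact hmeet c hc
    · have haB : a ∉ B := fun h' => has (hB h')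
      refine ⟨insert a B, Finset.insert_subset_insert _ hB, ?_, fun c hc => ?_⟩
      · rw [Finset.sum_insert haB, Finset.biUnion_insert]
        have h1 := Finset.card_union_add_card_inter ((Fs (m a)).image (· * a))
          (B.biUnion fun c' => (Fs (m c')).image (· * c'))
        rw [card_image_mul_right] at h1
        have h2 : (((Fs (m a)).image (· * a) ∪
            B.biUnion fun c' => (Fs (m c')).image (· * c')).card : ℝ) +
          (((Fs (m a)).image (· * a) ∩
            B.biUnion fun c' => (Fs (m c')).image (· * c')).card : ℝ) =
          (Fs (m a)).card + ((B.biUnion fun c' => (Fs (m c')).image (· * c')).card : ℝ) := by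
          exact_mod_cast h1
        push Not at h
        linarith
      · rcases Finset.mem_insert.1 hc with rfl | hc
        · have hsub : (Fs (m c)).image (· * c) ⊆
              ((insert c B).filter fun c' => m c ≤ m c').biUnion
                fun c' => (Fs (m c')).image (· * c') :=
            Finset.subset_biUnion_of_mem (fun c' => (Fs (m c')).image (· * c')) (by simp)
          rw [Finset.inter_eq_left.2 hsub, card_image_mul_right]
          have : (0 : ℝ) ≤ (Fs (m c)).card := by positivity
          nlinarith
        · refine (hmeet c hc).trans ?_
          gcongr
          exact Finset.subset_insert _ _

/-- A Vitali-type covering lemma for tempered sequences. -/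
theorem exists_almost_disjoint_translates [Group G] [DecidableEq G] {Fs : ℕ → Finset G}
    (hne : ∀ n, (Fs n).Nonempty) {C : ℝ}
    (hC : ∀ n : ℕ, ((((Finset.range n).biUnion fun k => (Fs k)⁻¹ * Fs n).card : ℝ))
      ≤ C * ((Fs n).card : ℝ))
    {ε : ℝ} (hε0 : 0 < ε) (hε1 : ε < 1) (m : G → ℕ) (A : Finset G) :
    ∃ B ⊆ A,
      (1 - ε) * ∑ c ∈ B, ((Fs (m c)).card : ℝ)
        ≤ ((B.biUnion fun c => (Fs (m c)).image (· * c)).card : ℝ) ∧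
      (A.card : ℝ) ≤ (C + ε⁻¹) * ∑ c ∈ B, ((Fs (m c)).card : ℝ) := by
  obtain ⟨B, hBA, hdisj, hmeet⟩ := exists_greedy_translates Fs hε1 m A
  refine ⟨B, hBA, hdisj, ?_⟩
  have hpos : ∀ n, (0 : ℝ) < (Fs n).card := fun n => by exact_mod_cast (hne n).card_pos
  -- the weight with which a selected translate accounts for a given translate
  let T : G → Finset G := fun c' =>
    ((Finset.range (m c')).biUnion fun k => (Fs k)⁻¹ * Fs (m c')).image (· * c')
  let w : G → G → ℝ := fun c c' => (if c ∈ T c' then 1 else 0) +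
    if m c = m c' then ε⁻¹ * ((Fs (m c')).card : ℝ)⁻¹ *
      (((Fs (m c')).image (· * c) ∩ (Fs (m c')).image (· * c')).card : ℝ) else 0
  have hw0 : ∀ c c', 0 ≤ w c c' := fun c c' => by
    have := (hpos (m c')).le
    simp only [w]; positivity
  have hw1 : ∀ c ∈ A, 1 ≤ ∑ c' ∈ B, w c c' := by
    intro c hc
    by_cases h : ∃ c' ∈ B, c ∈ T c'
    · obtain ⟨c', hc', hT⟩ := h
      refine le_trans ?_ (Finset.single_le_sum (fun i _ => hw0 c i) hc')
      have := (hpos (m c')).le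
      simp only [w, hT, if_true]
      have : 0 ≤ (if m c = m c' then ε⁻¹ * ((Fs (m c')).card : ℝ)⁻¹ *
        (((Fs (m c')).image (· * c) ∩ (Fs (m c')).image (· * c')).card : ℝ) else 0) := by
        positivity
      linarith
    · push Not at h
      have hsub : (Fs (m c)).image (· * c) ∩
          (B.filter fun c' => m c ≤ m c').biUnion (fun c' => (Fs (m c')).image (· * c')) ⊆
          (B.filter fun c' => m c = m c').biUnion
            fun c' => (Fs (m c')).image (· * c) ∩ (Fs (m c')).image (· * c') := by
        intro x hx
        obtain ⟨hx1, hx2⟩ := Finset.mem_inter.1 hx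
        obtain ⟨c', hc', hxc'⟩ := Finset.mem_biUnion.1 hx2
        obtain ⟨hc'B, hle⟩ := Finset.mem_filter.1 hc'
        rcases hle.lt_or_eq with hlt | heq
        · exfalso
          refine h c' hc'B ?_
          obtain ⟨u, hu, rfl⟩ := Finset.mem_image.1 hx1
          obtain ⟨v, hv, hvu⟩ := Finset.mem_image.1 hxc'
          refine Finset.mem_image.2 ⟨u⁻¹ * v, Finset.mem_biUnion.2 ⟨m c, by simpa using hlt,
            Finset.mul_mem_mul (Finset.inv_mem_inv hu) hv⟩, ?_⟩
          simp only [mul_assoc, hvu]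
          group
        · refine Finset.mem_biUnion.2 ⟨c', by simp [hc'B, heq], ?_⟩
          rw [← heq] at hxc' ⊢
          exact Finset.mem_inter.2 ⟨hx1, hxc'⟩
      have h1 : ε * ((Fs (m c)).card : ℝ) ≤ ∑ c' ∈ B.filter (fun c' => m c = m c'),
          (((Fs (m c')).image (· * c) ∩ (Fs (m c')).image (· * c')).card : ℝ) := by
        refine (hmeet c hc).trans ?_
        exact_mod_cast (Finset.card_le_card hsub).trans Finset.card_biUnion_le
      have h2 : ∑ c' ∈ B.filter (fun c' => m c = m c'), ε⁻¹ * ((Fs (m c)).card : ℝ)⁻¹ *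
          (((Fs (m c')).image (· * c) ∩ (Fs (m c')).image (· * c')).card : ℝ)
          ≤ ∑ c' ∈ B, w c c' := by
        rw [Finset.sum_filter]
        refine Finset.sum_le_sum fun c' _ => ?_
        simp only [w]
        split_ifs with h3 h4 <;> simp [h3]
      refine le_trans ?_ h2
      rw [← Finset.mul_sum]
      have := hpos (m c)
      calc (1 : ℝ) = ε⁻¹ * ((Fs (m c)).card : ℝ)⁻¹ * (ε * (Fs (m c)).card) := by field_simp
        _ ≤ _ := by gcongr
  have hw2 : ∀ c' ∈ B, ∑ c ∈ A, w c c' ≤ (C + ε⁻¹) * ((Fs (m c')).card : ℝ) := by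
    intro c' _
    simp only [w]
    rw [Finset.sum_add_distrib, add_mul]
    refine add_le_add ?_ ?_
    · rw [← Finset.sum_filter, Finset.sum_const, nsmul_eq_mul, mul_one]
      refine le_trans ?_ (hC (m c'))
      have hle : (A.filter fun c => c ∈ T c').card ≤ (T c').card :=
        Finset.card_le_card fun x hx => (Finset.mem_filter.1 hx).2
      rw [card_image_mul_right] at hle
      exact_mod_cast hle
    · have := hpos (m c')
      calc _ ≤ ∑ c ∈ A, ε⁻¹ * ((Fs (m c')).card : ℝ)⁻¹ *
            (((Fs (m c')).image (· * c) ∩ (Fs (m c')).image (· * c')).card : ℝ) := by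
            refine Finset.sum_le_sum fun c _ => ?_
            split_ifs
            · exact le_rfl
            · positivity
        _ ≤ ε⁻¹ * ((Fs (m c')).card : ℝ)⁻¹ * ((Fs (m c')).card * (Fs (m c')).card) := by
            rw [← Finset.mul_sum]
            gcongr
            have := sum_card_image_mul_inter_le A (Fs (m c')) ((Fs (m c')).image (· * c'))
            rw [card_image_mul_right] at this
            exact_mod_cast this
        _ = _ := by field_simp
  calc (A.card : ℝ) = ∑ c ∈ A, (1 : ℝ) := by simp
    _ ≤ ∑ c ∈ A, ∑ c' ∈ B, w c c' := Finset.sum_le_sum hw1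
    _ = ∑ c' ∈ B, ∑ c ∈ A, w c c' := Finset.sum_comm
    _ ≤ ∑ c' ∈ B, (C + ε⁻¹) * ((Fs (m c')).card : ℝ) := Finset.sum_le_sum hw2
    _ = _ := by rw [Finset.mul_sum]

/-- The total boundary of `Fs n` relative to a finite set is eventually small. -/
theorem Folner.eventually_sum_card_symmDiff_le [Group G] [DecidableEq G] {Fs : ℕ → Finset G}
    (hFol : Folner Fs) (K : Finset G) {η : ℝ} (hη : 0 < η) :
    ∀ᶠ n in atTop, ∑ g ∈ K, ((((Fs n).image fun h => g * h) ∆ Fs n).card : ℝ)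
      ≤ η * ((Fs n).card : ℝ) := by
  have h : Tendsto (fun n => ∑ g ∈ K,
      ((((Fs n).image fun h => g * h) ∆ Fs n).card : ℝ) / ((Fs n).card : ℝ)) atTop (𝓝 0) := by
    simpa using tendsto_finsetSum K fun g _ => hFol.2 g
  filter_upwards [h.eventually_le_const hη] with n hn
  have hpos : (0 : ℝ) < (Fs n).card := by exact_mod_cast (hFol.1 n).card_pos
  rwa [← Finset.sum_div, div_le_iff₀ hpos] at hn

/-- `Q δ y A t` abstracts the assertion that a dynamical quantity attached to the orbit piece `A y`
at scale `δ` is at most `t`: it is subadditive in `A`, equivariant, and at most `κ * |A|`. -/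
structure IsOrbitCost [Group G] [DecidableEq G] (act : G → Y → Y)
    (Q : ℝ → Y → Finset G → ℝ → Prop) (κ : ℝ) : Prop where
  union : ∀ {δ y A B s t}, Q δ y A s → Q δ y B t → Q δ y (A ∪ B) (s + t)
  translate : ∀ {δ y A t} (c : G), Q δ (act c y) A t → Q δ y (A.image (· * c)) t
  anti : ∀ {δ δ' y A t}, δ' ≤ δ → Q δ y A t → Q δ' y A t
  mono : ∀ {δ y A s t}, s ≤ t → Q δ y A s → Q δ y A t
  trivial : ∀ δ y (A : Finset G), Q δ y A (κ * A.card)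

/-- Along `Fs`, orbit pieces can be tiled up to a proportion `ρ` by a set with small boundary which
carries a cost `a * W`, where `W` is almost the size of the set. -/
def TilesUpTo [Group G] [DecidableEq G] (Fs : ℕ → Finset G)
    (Q : ℝ → Y → Finset G → ℝ → Prop) (a ε ρ : ℝ) : Prop :=
  ∀ (K : Finset G) (η : ℝ), 0 < η → ∃ δ > 0, ∃ N : ℕ, ∀ n ≥ N, ∀ y : Y, ∃ U ⊆ Fs n, ∃ W : ℝ,
    Q δ y U (a * W) ∧ (1 - ε) * W ≤ (U.card : ℝ) ∧
    ((Fs n \ U).card : ℝ) ≤ ρ * (Fs n).card ∧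
    ∑ g ∈ K, (((U.image fun h => g * h) \ U).card : ℝ) ≤ η * (Fs n).card

theorem IsOrbitCost.empty [Group G] [DecidableEq G] {act : G → Y → Y}
    {Q : ℝ → Y → Finset G → ℝ → Prop} {κ : ℝ} (hQ : IsOrbitCost act Q κ) (δ : ℝ) (y : Y) :
    Q δ y ∅ 0 := by
  simpa using hQ.trivial δ y ∅

theorem IsOrbitCost.biUnion [Group G] [DecidableEq G] {act : G → Y → Y}
    {Q : ℝ → Y → Finset G → ℝ → Prop} {κ : ℝ} (hQ : IsOrbitCost act Q κ) {δ : ℝ} {y : Y}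
    {ι : Type*} (B : Finset ι) (A : ι → Finset G) (t : ι → ℝ) (h : ∀ i ∈ B, Q δ y (A i) (t i)) :
    Q δ y (B.biUnion A) (∑ i ∈ B, t i) := by
  classical
  induction B using Finset.induction_on with
  | empty => simpa using hQ.empty δ y
  | insert i B hi ih =>
    rw [Finset.biUnion_insert, Finset.sum_insert hi]
    exact hQ.union (h i (by simp)) (ih fun j hj => h j (by simp [hj]))

/-- Points of `F \ U` moved out of `F \ U` by some element of `K` lie near a boundary. -/
theorem card_sdiff_le_card_core_add [Group G] [DecidableEq G] (K F U : Finset G) :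
    ((F \ U).card : ℝ) ≤ (((F \ U).filter fun c => ∀ g ∈ K, g * c ∈ F \ U).card : ℝ) +
      ∑ g ∈ K⁻¹, (((F.image fun h => g * h) ∆ F).card : ℝ) +
      ∑ g ∈ K⁻¹, (((U.image fun h => g * h) \ U).card : ℝ) := by
  have hsub : F \ U ⊆ ((F \ U).filter fun c => ∀ g ∈ K, g * c ∈ F \ U) ∪
      (K⁻¹.biUnion fun g => (F.image fun h => g * h) ∆ F) ∪
      (K⁻¹.biUnion fun g => (U.image fun h => g * h) \ U) := by
    intro c hc
    obtain ⟨hcF, hcU⟩ := Finset.mem_sdiff.1 hc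
    by_cases h : ∀ g ∈ K, g * c ∈ F \ U
    · exact Finset.mem_union_left _ (Finset.mem_union_left _ (Finset.mem_filter.2 ⟨hc, h⟩))
    · push Not at h
      obtain ⟨g, hg, hgc⟩ := h
      by_cases hgF : g * c ∈ F
      · have hgU : g * c ∈ U := by
          by_contra hgU
          exact hgc (Finset.mem_sdiff.2 ⟨hgF, hgU⟩)
        refine Finset.mem_union_right _ (Finset.mem_biUnion.2 ⟨g⁻¹, Finset.inv_mem_inv hg, ?_⟩)
        exact Finset.mem_sdiff.2 ⟨Finset.mem_image.2 ⟨g * c, hgU, by group⟩, hcU⟩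
      · refine Finset.mem_union_left _ (Finset.mem_union_right _
          (Finset.mem_biUnion.2 ⟨g⁻¹, Finset.inv_mem_inv hg, ?_⟩))
        refine Finset.mem_symmDiff.2 (Or.inr ⟨hcF, fun hmem => hgF ?_⟩)
        obtain ⟨h, hh, rfl⟩ := Finset.mem_image.1 hmem
        simpa using hh
  have h1 := (Finset.card_le_card hsub).trans (Finset.card_union_le _ _)
  have h2 := Finset.card_union_le ((F \ U).filter fun c => ∀ g ∈ K, g * c ∈ F \ U)
    (K⁻¹.biUnion fun g => (F.image fun h => g * h) ∆ F)
  have h3 := Finset.card_biUnion_le (s := K⁻¹) (t := fun g => (F.image fun h => g * h) ∆ F)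
  have h4 := Finset.card_biUnion_le (s := K⁻¹) (t := fun g => (U.image fun h => g * h) \ U)
  exact_mod_cast (show _ ≤ _ by omega)

theorem card_image_mul_left_sdiff_translate_le [Group G] [DecidableEq G] (F : Finset G) (g c : G) :
    (((F.image (· * c)).image fun h => g * h) \ F.image (· * c)).card ≤
      ((F.image fun h => g * h) ∆ F).card := by
  rw [← card_image_mul_right ((F.image fun h => g * h) ∆ F) c]
  refine Finset.card_le_card fun x hx => ?_
  obtain ⟨hx1, hx2⟩ := Finset.mem_sdiff.1 hx
  obtain ⟨z, hz, rfl⟩ := Finset.mem_image.1 hx1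
  obtain ⟨v, hv, rfl⟩ := Finset.mem_image.1 hz
  refine Finset.mem_image.2 ⟨g * v, Finset.mem_symmDiff.2 (Or.inl
    ⟨Finset.mem_image_of_mem _ hv, fun h => hx2 ?_⟩), by simp [mul_assoc]⟩
  exact Finset.mem_image.2 ⟨g * v, h, by simp [mul_assoc]⟩

/-- The boundary of `U ∪ ⋃ c ∈ B, F c c` is controlled by those of `U` and of the tiles. -/
theorem sum_card_boundary_union_le [Group G] [DecidableEq G] (K U B : Finset G)
    (F : G → Finset G) :
    ∑ g ∈ K, ((((U ∪ B.biUnion fun c => (F c).image (· * c)).image fun h => g * h) \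
        (U ∪ B.biUnion fun c => (F c).image (· * c))).card : ℝ) ≤
      ∑ g ∈ K, (((U.image fun h => g * h) \ U).card : ℝ) +
      ∑ c ∈ B, ∑ g ∈ K, ((((F c).image fun h => g * h) ∆ F c).card : ℝ) := by
  rw [Finset.sum_comm (s := B), ← Finset.sum_add_distrib]
  refine Finset.sum_le_sum fun g _ => ?_
  have hsub : ((U ∪ B.biUnion fun c => (F c).image (· * c)).image fun h => g * h) \
      (U ∪ B.biUnion fun c => (F c).image (· * c)) ⊆ ((U.image fun h => g * h) \ U) ∪
      B.biUnion fun c => (((F c).image (· * c)).image fun h => g * h) \ (F c).image (· * c) := by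
    intro x hx
    obtain ⟨hx1, hx2⟩ := Finset.mem_sdiff.1 hx
    rw [Finset.mem_union, not_or] at hx2
    obtain ⟨z, hz, rfl⟩ := Finset.mem_image.1 hx1
    rcases Finset.mem_union.1 hz with hz | hz
    · exact Finset.mem_union_left _ (Finset.mem_sdiff.2 ⟨Finset.mem_image_of_mem _ hz, hx2.1⟩)
    · obtain ⟨c, hc, hzc⟩ := Finset.mem_biUnion.1 hz
      refine Finset.mem_union_right _ (Finset.mem_biUnion.2 ⟨c, hc, Finset.mem_sdiff.2
        ⟨Finset.mem_image_of_mem _ hzc, fun h => hx2.2 (Finset.mem_biUnion.2 ⟨c, hc, h⟩)⟩⟩)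
  have h1 := (Finset.card_le_card hsub).trans (Finset.card_union_le _ _)
  have h2 := (Finset.card_biUnion_le (s := B) (t := fun c =>
    (((F c).image (· * c)).image fun h => g * h) \ (F c).image (· * c))).trans
    (Finset.sum_le_sum fun c _ => card_image_mul_left_sdiff_translate_le (F c) g c)
  exact_mod_cast h1.trans (Nat.add_le_add_left h2 _)

/-- Adding one more layer of tiles reduces the uncovered proportion by a fixed factor. -/
theorem TilesUpTo.step [Group G] [DecidableEq G] {Fs : ℕ → Finset G} (hFol : Folner Fs)
    {C : ℝ} (hC0 : 0 < C)
    (hC : ∀ n : ℕ, ((((Finset.range n).biUnion fun k => (Fs k)⁻¹ * Fs n).card : ℝ))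
      ≤ C * ((Fs n).card : ℝ))
    {act : G → Y → Y} {Q : ℝ → Y → Finset G → ℝ → Prop} {κ : ℝ} (hQ : IsOrbitCost act Q κ)
    {a : ℝ}
    (hgood : ∀ M : ℕ, ∃ δ > 0, ∃ M' : ℕ, ∃ m : Y → ℕ, ∀ y, M ≤ m y ∧ m y ≤ M' ∧
      Q δ y (Fs (m y)) (a * (Fs (m y)).card))
    {ε : ℝ} (hε0 : 0 < ε) (hε1 : ε < 1) {ρ θ : ℝ} (hθ : 0 < θ) (h : TilesUpTo Fs Q a ε ρ) :
    TilesUpTo Fs Q a ε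
      ((1 - (1 - ε) / (C + ε⁻¹)) * ρ + (1 - ε) / (C + ε⁻¹) * θ) := by
  intro K η hη
  set c₀ := (1 - ε) / (C + ε⁻¹) with hc₀
  have hε2 : 0 < 1 - ε := by linarith
  have hD : 0 < C + ε⁻¹ := by positivity
  have hc₀0 : 0 < c₀ := by positivity
  have hc₀1 : c₀ ≤ 1 := by
    rw [hc₀, div_le_one hD]
    have : 1 ≤ ε⁻¹ := (one_le_inv₀ hε0).2 hε1.le
    linarith
  obtain ⟨M, hM⟩ := eventually_atTop.1
    (hFol.eventually_sum_card_symmDiff_le K (η := (1 - ε) * (η / 2)) (by positivity))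
  obtain ⟨δ₁, hδ₁, M', m, hm⟩ := hgood M
  let K₁ : Finset G := (Finset.Icc M M').biUnion Fs
  obtain ⟨δ₂, hδ₂, N₂, hN₂⟩ := h (K ∪ K₁⁻¹) (min (η / 2) (θ / 2)) (by positivity)
  obtain ⟨N₃, hN₃⟩ := eventually_atTop.1
    (hFol.eventually_sum_card_symmDiff_le K₁⁻¹ (η := θ / 2) (by positivity))
  refine ⟨min δ₁ δ₂, lt_min hδ₁ hδ₂, max N₂ N₃, fun n hn y => ?_⟩
  obtain ⟨U, hUF, W, hQU, hW, hR, hbd⟩ := hN₂ n (le_trans (le_max_left _ _) hn) y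
  have hFn := hN₃ n (le_trans (le_max_right _ _) hn)
  set A := (Fs n \ U).filter fun c => ∀ g ∈ K₁, g * c ∈ Fs n \ U with hA
  obtain ⟨B, hBA, hBdisj, hBA'⟩ := exists_almost_disjoint_translates hFol.1 hC hε0 hε1
    (fun c => m (act c y)) A
  set V := B.biUnion fun c => (Fs (m (act c y))).image (· * c) with hV
  set S := ∑ c ∈ B, ((Fs (m (act c y))).card : ℝ) with hS
  have hVsub : V ⊆ Fs n \ U := by
    intro x hx
    obtain ⟨c, hc, hxc⟩ := Finset.mem_biUnion.1 hx
    obtain ⟨g, hg, rfl⟩ := Finset.mem_image.1 hxc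
    refine (Finset.mem_filter.1 (hBA hc)).2 g (Finset.mem_biUnion.2 ⟨_, ?_, hg⟩)
    exact Finset.mem_Icc.2 ⟨(hm _).1, (hm _).2.1⟩
  have hVU : Disjoint U V := Finset.disjoint_left.2 fun x hxU hxV =>
    (Finset.mem_sdiff.1 (hVsub hxV)).2 hxU
  have hn0 : (0 : ℝ) ≤ (Fs n).card := by positivity
  have hsumK : ∀ L ⊆ K ∪ K₁⁻¹, ∀ b, min (η / 2) (θ / 2) ≤ b →
      ∑ g ∈ L, (((U.image fun h => g * h) \ U).card : ℝ) ≤ b * (Fs n).card := by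
    intro L hL b hb
    refine (Finset.sum_le_sum_of_subset_of_nonneg hL fun _ _ _ => by positivity).trans
      (hbd.trans ?_)
    gcongr
  refine ⟨U ∪ V, Finset.union_subset hUF (hVsub.trans Finset.sdiff_subset), W + S, ?_, ?_, ?_, ?_⟩
  · rw [mul_add]
    refine hQ.union (hQ.anti (min_le_right _ _) hQU) ?_
    rw [hS, Finset.mul_sum]
    exact hQ.biUnion B _ _ fun c _ =>
      hQ.anti (min_le_left _ _) (hQ.translate c (hm (act c y)).2.2)
  · rw [Finset.card_union_of_disjoint hVU, mul_add]
    push_cast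
    linarith
  · have hcard : ((Fs n \ (U ∪ V)).card : ℝ) = ((Fs n \ U).card : ℝ) - V.card := by
      rw [← Finset.cast_card_sdiff hVsub, sdiff_sdiff_left, Finset.sup_eq_union]
    have h1 := card_sdiff_le_card_core_add K₁ (Fs n) U
    have h2 := hsumK K₁⁻¹ Finset.subset_union_right _ (min_le_right _ _)
    have h3 : c₀ * A.card ≤ V.card := by
      refine le_trans ?_ hBdisj
      calc c₀ * A.card ≤ c₀ * ((C + ε⁻¹) * S) := by gcongr
        _ = (1 - ε) * S := by rw [hc₀]; field_simp
    have h4 : ((Fs n \ U).card : ℝ) ≤ A.card + θ * (Fs n).card := by linarith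
    have h5 : c₀ * ((Fs n \ U).card : ℝ) ≤ c₀ * A.card + c₀ * (θ * (Fs n).card) := by
      rw [← mul_add]; gcongr
    have h6 : (1 - c₀) * ((Fs n \ U).card : ℝ) ≤ (1 - c₀) * (ρ * (Fs n).card) :=
      mul_le_mul_of_nonneg_left hR (by linarith)
    rw [hcard]
    linarith
  · have h1 := sum_card_boundary_union_le K U B fun c => Fs (m (act c y))
    have h2 := hsumK K Finset.subset_union_left _ (min_le_left _ _)
    have h3 : ∑ c ∈ B, ∑ g ∈ K, ((((Fs (m (act c y))).image fun h => g * h) ∆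
        Fs (m (act c y))).card : ℝ) ≤ (1 - ε) * (η / 2) * S := by
      rw [hS, Finset.mul_sum]
      exact Finset.sum_le_sum fun c _ => hM _ (hm (act c y)).1
    have h4 : (V.card : ℝ) ≤ (Fs n).card := by
      exact_mod_cast Finset.card_le_card (hVsub.trans Finset.sdiff_subset)
    have h5 : (1 - ε) * S * (η / 2) ≤ (Fs n).card * (η / 2) :=
      mul_le_mul_of_nonneg_right (hBdisj.trans h4) (by positivity)
    refine h1.trans ?_
    linarith

/-- Subadditivity along tempered Følner sequences: if every point has arbitrarily late times, within
a bounded range, at which the cost per element is at most `a`, then eventually the cost per element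
is uniformly at most `a + η`. -/
theorem IsOrbitCost.exists_uniform_bound [Group G] [DecidableEq G] {Fs : ℕ → Finset G}
    (hFol : Folner Fs) (htemp : Tempered Fs)
    {act : G → Y → Y} {Q : ℝ → Y → Finset G → ℝ → Prop} {κ : ℝ} (hκ : 0 ≤ κ)
    (hQ : IsOrbitCost act Q κ) {a : ℝ} (ha : 0 < a)
    (hgood : ∀ M : ℕ, ∃ δ > 0, ∃ M' : ℕ, ∃ m : Y → ℕ, ∀ y, M ≤ m y ∧ m y ≤ M' ∧
      Q δ y (Fs (m y)) (a * (Fs (m y)).card))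
    {η : ℝ} (hη : 0 < η) :
    ∃ δ > 0, ∃ N : ℕ, ∀ n ≥ N, ∀ y, Q δ y (Fs n) ((a + η) * (Fs n).card) := by
  obtain ⟨C, hC0, hC⟩ := htemp
  let ε : ℝ := (η / 2) / (a + η / 2)
  have hε0 : 0 < ε := by positivity
  have hε1 : ε < 1 := by
    simp only [ε]; rw [div_lt_one (by positivity)]; linarith
  have hε2 : 0 < 1 - ε := by linarith
  have hεa : (a + η / 2) * (1 - ε) = a := by
    simp only [ε]; field_simp; ring
  set c₀ := (1 - ε) / (C + ε⁻¹) with hc₀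
  have hc₀0 : 0 < c₀ := by positivity
  have hc₀1 : c₀ ≤ 1 := by
    rw [hc₀, div_le_one (by positivity)]
    have : 1 ≤ ε⁻¹ := (one_le_inv₀ hε0).2 hε1.le
    linarith
  have hr0 : 0 < 1 - c₀ / 2 := by linarith
  have htiles : ∀ L : ℕ, TilesUpTo Fs Q a ε ((1 - c₀ / 2) ^ L) := by
    intro L
    induction L with
    | zero =>
      intro K η' hη'
      refine ⟨1, one_pos, 0, fun n _ y => ⟨∅, by simp, 0, ?_, by simp, by simp, ?_⟩⟩
      · simpa using hQ.empty 1 y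
      · simp; positivity
    | succ L ih =>
      have := TilesUpTo.step hFol hC0 hC hQ hgood hε0 hε1
        (θ := (1 - c₀ / 2) ^ L / 2) (by positivity) ih
      rw [← hc₀] at this
      convert this using 1
      ring
  obtain ⟨L, hL⟩ := exists_pow_lt_of_lt_one (show 0 < (η / 2) / (κ + 1) by positivity)
    (show 1 - c₀ / 2 < 1 by linarith)
  obtain ⟨δ, hδ, N, hN⟩ := htiles L ∅ 1 one_pos
  refine ⟨δ, hδ, N, fun n hn y => ?_⟩
  obtain ⟨U, hUF, W, hQU, hW, hR, -⟩ := hN n hn y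
  have hQn := hQ.union hQU (hQ.trivial δ y (Fs n \ U))
  rw [Finset.union_sdiff_of_subset hUF] at hQn
  refine hQ.mono ?_ hQn
  have hn0 : (0 : ℝ) ≤ (Fs n).card := by positivity
  have hU : (U.card : ℝ) ≤ (Fs n).card := by exact_mod_cast Finset.card_le_card hUF
  have h1 : a * W ≤ (a + η / 2) * (Fs n).card := by
    calc a * W = (a + η / 2) * ((1 - ε) * W) := by rw [← mul_assoc, hεa]
      _ ≤ _ := by gcongr; exact hW.trans hU
  have h2 : κ * (1 - c₀ / 2) ^ L ≤ η / 2 := by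
    rw [lt_div_iff₀ (by positivity)] at hL
    have : (0 : ℝ) < (1 - c₀ / 2) ^ L := by positivity
    linarith
  have h3 : κ * ((Fs n \ U).card : ℝ) ≤ η / 2 * (Fs n).card := by
    calc κ * ((Fs n \ U).card : ℝ) ≤ κ * ((1 - c₀ / 2) ^ L * (Fs n).card) := by gcongr
      _ = κ * (1 - c₀ / 2) ^ L * (Fs n).card := by ring
      _ ≤ _ := by gcongr
  linarith

/-- `Z` is covered by at most `exp t` sets of `d_A`-diameter at most `ε`. -/
def HasDynCover [PseudoMetricSpace X] (act : G → X → X) (ε : ℝ) (Z : Set X) (A : Finset G)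
    (t : ℝ) : Prop :=
  ∃ S : Finset (Set X), (S.card : ℝ) ≤ Real.exp t ∧ (∀ z ∈ Z, ∃ s ∈ S, z ∈ s) ∧
    ∀ s ∈ S, ∀ x ∈ s, ∀ y ∈ s, ∀ g ∈ A, dist (act g x) (act g y) ≤ ε

namespace HasDynCover

variable [PseudoMetricSpace X] {act : G → X → X} {ε : ℝ}

theorem subset {Z Z' : Set X} {A : Finset G} {t : ℝ} (h : HasDynCover act ε Z A t)
    (hZ : Z' ⊆ Z) : HasDynCover act ε Z' A t := by
  obtain ⟨S, h1, h2, h3⟩ := h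
  exact ⟨S, h1, fun z hz => h2 z (hZ hz), h3⟩

theorem mono {Z : Set X} {A : Finset G} {s t : ℝ} (h : HasDynCover act ε Z A s)
    (hst : s ≤ t) : HasDynCover act ε Z A t := by
  obtain ⟨S, h1, h2, h3⟩ := h
  exact ⟨S, h1.trans (Real.exp_le_exp.2 hst), h2, h3⟩

theorem inter [DecidableEq G] {Z Z' : Set X} {A B : Finset G} {s t : ℝ}
    (h : HasDynCover act ε Z A s) (h' : HasDynCover act ε Z' B t) :
    HasDynCover act ε (Z ∩ Z') (A ∪ B) (s + t) := by
  classical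
  obtain ⟨S, h1, h2, h3⟩ := h
  obtain ⟨S', h1', h2', h3'⟩ := h'
  refine ⟨(S ×ˢ S').image fun p => p.1 ∩ p.2, ?_, fun z hz => ?_, fun u hu x hx y hy g hg => ?_⟩
  · rw [Real.exp_add]
    calc (((S ×ˢ S').image fun p => p.1 ∩ p.2).card : ℝ) ≤ ((S ×ˢ S').card : ℝ) := by
          exact_mod_cast Finset.card_image_le
      _ = S.card * S'.card := by rw [Finset.card_product]; push_cast; rfl
      _ ≤ _ := by gcongr
  · obtain ⟨s, hs, hzs⟩ := h2 z hz.1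
    obtain ⟨s', hs', hzs'⟩ := h2' z hz.2
    exact ⟨s ∩ s', Finset.mem_image.2 ⟨(s, s'), Finset.mem_product.2 ⟨hs, hs'⟩, rfl⟩, hzs, hzs'⟩
  · obtain ⟨⟨s, s'⟩, hp, rfl⟩ := Finset.mem_image.1 hu
    obtain ⟨hs, hs'⟩ := Finset.mem_product.1 hp
    rcases Finset.mem_union.1 hg with hg | hg
    · exact h3 s hs x hx.1 y hy.1 g hg
    · exact h3' s' hs' x hx.2 y hy.2 g hg

theorem translate [Group G] [DecidableEq G]
    (hmul : ∀ g h x, act (g * h) x = act g (act h x)) {Z : Set X} {A : Finset G} {t : ℝ} (c : G)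
    (h : HasDynCover act ε Z A t) :
    HasDynCover act ε (act c ⁻¹' Z) (A.image (· * c)) t := by
  classical
  obtain ⟨S, h1, h2, h3⟩ := h
  refine ⟨S.image fun s => act c ⁻¹' s, ?_, fun z hz => ?_, fun u hu x hx y hy g hg => ?_⟩
  · exact le_trans (by exact_mod_cast Finset.card_image_le) h1
  · obtain ⟨s, hs, hzs⟩ := h2 _ hz
    exact ⟨_, Finset.mem_image_of_mem _ hs, hzs⟩
  · obtain ⟨s, hs, rfl⟩ := Finset.mem_image.1 hu
    obtain ⟨k, hk, rfl⟩ := Finset.mem_image.1 hg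
    rw [hmul, hmul]
    exact h3 s hs _ hx _ hy k hk

theorem card_le_of_isDynSeparated {Z : Set X} {A : Finset G} {t : ℝ}
    (h : HasDynCover act ε Z A t) {E : Finset X} (hEZ : ↑E ⊆ Z)
    (hE : IsDynSeparated act A ε ↑E) : (E.card : ℝ) ≤ Real.exp t := by
  obtain ⟨S, h1, h2, h3⟩ := h
  refine le_trans ?_ h1
  have : ∀ z : X, ∃ s : Set X, z ∈ E → s ∈ S ∧ z ∈ s := fun z => by
    by_cases hz : z ∈ E
    · obtain ⟨s, hs⟩ := h2 z (hEZ hz)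
      exact ⟨s, fun _ => hs⟩
    · exact ⟨∅, fun h => absurd h hz⟩
  choose f hf using this
  exact_mod_cast Finset.card_le_card_of_injOn f (fun z hz => (hf z hz).1)
    fun x hx y hy hxy => by
      by_contra hne
      obtain ⟨g, hg, hlt⟩ := hE x hx y hy hne
      exact absurd (h3 (f x) (hf x hx).1 x (hf x hx).2 y (hxy ▸ (hf y hy).2) g hg) (not_le.2 hlt)

theorem sepNum_le {Z : Set X} {A : Finset G} {t : ℝ} (h : HasDynCover act ε Z A t) :
    (sepNum act A Z ε : ℝ) ≤ Real.exp t := by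
  have : sepNum act A Z ε ≤ ⌊Real.exp t⌋₊ := by
    refine csSup_le' fun k hk => ?_
    obtain ⟨E, hEZ, hE, rfl⟩ := hk
    exact Nat.le_floor (h.card_le_of_isDynSeparated hEZ hE)
  exact (Nat.le_floor_iff (Real.exp_pos t).le).1 this

theorem card_le_sepNum {Z : Set X} {A : Finset G} {t : ℝ} (h : HasDynCover act ε Z A t)
    {E : Finset X} (hEZ : ↑E ⊆ Z) (hE : IsDynSeparated act A ε ↑E) :
    E.card ≤ sepNum act A Z ε := by
  refine le_csSup ⟨⌊Real.exp t⌋₊, fun k hk => ?_⟩ ⟨E, hEZ, hE, rfl⟩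
  obtain ⟨E', hEZ', hE', rfl⟩ := hk
  exact Nat.le_floor (h.card_le_of_isDynSeparated hEZ' hE')

/-- A separated set of maximal cardinality spans. -/
theorem exists_spanning (hε : 0 ≤ ε) {Z : Set X} {A : Finset G} {t : ℝ}
    (h : HasDynCover act ε Z A t) :
    ∃ E : Finset X, ↑E ⊆ Z ∧ E.card ≤ sepNum act A Z ε ∧
      ∀ z ∈ Z, ∃ x ∈ E, z ∈ dynClosedBall act A x ε := by
  classical
  have hfin : {k : ℕ | ∃ E : Finset X, ↑E ⊆ Z ∧ IsDynSeparated act A ε ↑E ∧ E.card = k}.Finite :=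
    (Set.finite_Iic ⌊Real.exp t⌋₊).subset fun k hk => by
      obtain ⟨E', hEZ', hE', rfl⟩ := hk
      exact Nat.le_floor (h.card_le_of_isDynSeparated hEZ' hE')
  obtain ⟨k, ⟨E, hEZ, hE, rfl⟩, hmax⟩ := hfin.exists_maximal
    ⟨0, ∅, by simp, fun x hx => by simp at hx, rfl⟩
  refine ⟨E, hEZ, h.card_le_sepNum hEZ hE, fun z hz => ?_⟩
  by_contra hcon
  push Not at hcon
  have hsep : ∀ x ∈ E, ∃ g ∈ A, ε < dist (act g x) (act g z) := fun x hx => by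
    simpa [dynClosedBall] using hcon x hx
  by_cases hzE : z ∈ E
  · obtain ⟨g, -, hlt⟩ := hsep z hzE
    rw [dist_self] at hlt
    exact hlt.not_ge hε
  · have hmem : E.card + 1 ∈ {k : ℕ | ∃ E : Finset X, ↑E ⊆ Z ∧ IsDynSeparated act A ε ↑E ∧
        E.card = k} := by
      refine ⟨insert z E, ?_, ?_, Finset.card_insert_of_notMem hzE⟩
      · rw [Finset.coe_insert]
        exact Set.insert_subset hz hEZ
      · intro x hx y hy hxy
        rw [Finset.coe_insert] at hx hy
        rcases hx with rfl | hx <;> rcases hy with rfl | hy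
        · exact absurd rfl hxy
        · obtain ⟨g, hg, hlt⟩ := hsep y hy
          exact ⟨g, hg, by rwa [dist_comm]⟩
        · exact hsep x hx
        · exact hE x hx y hy hxy
    have := hmax hmem (Nat.le_succ _)
    omega

/-- In a compact space, dynamical covers have at most exponential cardinality. -/
theorem exists_univ [CompactSpace X] [DecidableEq G] (act : G → X → X) (hε : 0 < ε) :
    ∃ κ : ℝ, 0 ≤ κ ∧ ∀ A : Finset G, HasDynCover act ε univ A (κ * A.card) := by
  classical
  obtain ⟨t, -, htfin, ht⟩ := finite_cover_balls_of_compact (isCompact_univ (X := X)) (half_pos hε)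
  refine ⟨htfin.toFinset.card, by positivity, fun A => ?_⟩
  induction A using Finset.induction_on with
  | empty => exact ⟨{univ}, by simp, by simp, by simp⟩
  | insert g A hg ih =>
    have hone : HasDynCover act ε univ {g} (htfin.toFinset.card : ℝ) := by
      refine ⟨htfin.toFinset.image fun c => act g ⁻¹' Metric.ball c (ε / 2), ?_, fun z _ => ?_,
        fun u hu x hx y hy k hk => ?_⟩
      · refine le_trans (by exact_mod_cast Finset.card_image_le)
          ((le_add_of_nonneg_right zero_le_one).trans (Real.add_one_le_exp _))
      · obtain ⟨c, hc, hzc⟩ := mem_iUnion₂.1 (ht (mem_univ (act g z)))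
        exact ⟨_, Finset.mem_image_of_mem _ (htfin.mem_toFinset.2 hc), hzc⟩
      · obtain ⟨c, -, rfl⟩ := Finset.mem_image.1 hu
        obtain rfl := Finset.mem_singleton.1 hk
        have := dist_triangle_right (act k x) (act k y) c
        have hx' : dist (act k x) c < ε / 2 := hx
        have hy' : dist (act k y) c < ε / 2 := hy
        linarith
    have := hone.inter ih
    rw [univ_inter] at this
    rw [Finset.insert_eq, Finset.card_union_of_disjoint (Finset.disjoint_singleton_left.2 hg)]
    refine this.mono ?_
    rw [Finset.card_singleton]
    push_cast
    linarith

end HasDynCover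

theorem isOpen_dynBall [Group G] [PseudoMetricSpace X] {act : G → X → X}
    (hcont : ∀ g : G, Continuous (act g)) (F : Finset G) (x : X) (ε : ℝ) :
    IsOpen (dynBall act F x ε) := by
  have : dynBall act F x ε = ⋂ g ∈ F, {y | dist (act g x) (act g y) < ε} := by
    ext; simp [dynBall]
  rw [this]
  exact isOpen_biInter_finset fun g _ =>
    isOpen_lt (continuous_const.dist (hcont g)) continuous_const

/-- The logarithmic size of dynamical covers of preimages of Bowen balls is an orbit cost. -/
theorem isOrbitCost_hasDynCover [Group G] [DecidableEq G] [PseudoMetricSpace X]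
    [PseudoMetricSpace Y] {actX : G → X → X} {actY : G → Y → Y}
    (hX_mul : ∀ g h x, actX (g * h) x = actX g (actX h x))
    (hY_mul : ∀ g h y, actY (g * h) y = actY g (actY h y))
    {π : X → Y} (hπ_equiv : ∀ g x, π (actX g x) = actY g (π x)) {ε κ : ℝ}
    (hκ : ∀ A : Finset G, HasDynCover actX ε univ A (κ * A.card)) :
    IsOrbitCost actY
      (fun δ y A t => HasDynCover actX ε (π ⁻¹' dynClosedBall actY A y δ) A t) κ where
  union h h' := (h.inter h').subset fun x hx =>
    ⟨fun g hg => hx g (Finset.mem_union_left _ hg), fun g hg => hx g (Finset.mem_union_right _ hg)⟩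
  translate c h := (h.translate hX_mul c).subset fun x hx g hg => by
    rw [hπ_equiv, ← hY_mul, ← hY_mul]
    exact hx _ (Finset.mem_image_of_mem _ hg)
  anti hδ h := h.subset fun x hx g hg => (hx g hg).trans hδ
  mono hst h := h.mono hst
  trivial δ y A := (hκ A).subset (subset_univ _)

/-- A cover of a fiber also covers the preimage of a small Bowen ball. -/
theorem exists_hasDynCover_preimage_dynClosedBall [Group G] [PseudoMetricSpace X]
    [CompactSpace X] [MetricSpace Y] {actX : G → X → X} {actY : G → Y → Y}
    (hX_cont : ∀ g : G, Continuous (actX g))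
    (hY_one : ∀ y, actY 1 y = y) (hY_mul : ∀ g h y, actY (g * h) y = actY g (actY h y))
    (hY_cont : ∀ g : G, Continuous (actY g))
    {π : X → Y} (hπ_cont : Continuous π) {ε t : ℝ} (hε : 0 < ε) {F : Finset G}
    (hF : F.Nonempty) {y : Y} {E : Finset X} (hEcard : (E.card : ℝ) ≤ Real.exp t)
    (hE : ∀ x ∈ π ⁻¹' {y}, ∃ e ∈ E, x ∈ dynClosedBall actX F e (ε / 4)) :
    ∃ δ > 0, HasDynCover actX ε (π ⁻¹' dynClosedBall actY F y (2 * δ)) F t := by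
  classical
  let U : Set X := ⋃ e ∈ E, dynBall actX F e (ε / 2)
  have hU : IsOpen U := isOpen_biUnion fun e _ => isOpen_dynBall hX_cont F e _
  obtain ⟨g, hg⟩ := hF
  obtain ⟨r, hr, hrU⟩ := hU.isClosed_compl.isCompact.exists_forall_le'
    (f := fun x => dist (actY g y) (actY g (π x))) (a := 0)
    (continuous_const.dist ((hY_cont g).comp hπ_cont)).continuousOn (by
      intro x hx
      rw [dist_pos]
      intro heq
      have hxy : π x = y := by
        have := congrArg (actY g⁻¹) heq
        rw [← hY_mul, ← hY_mul, inv_mul_cancel, hY_one, hY_one] at this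
        exact this.symm
      obtain ⟨e, he, hxe⟩ := hE x hxy
      exact hx (mem_iUnion₂.2 ⟨e, he, fun k hk => (hxe k hk).trans_lt (by linarith)⟩))
  refine ⟨r / 3, by positivity, E.image fun e => dynBall actX F e (ε / 2), ?_, fun x hx => ?_,
    fun u hu x hx x' hx' k hk => ?_⟩
  · exact le_trans (by exact_mod_cast Finset.card_image_le) hEcard
  · have hxU : x ∈ U := by
      by_contra hxU
      have h1 := hrU x hxU
      have h2 : dist (actY g y) (actY g (π x)) ≤ 2 * (r / 3) := hx g hg
      linarith
    obtain ⟨e, he, hxe⟩ := mem_iUnion₂.1 hxU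
    exact ⟨_, Finset.mem_image_of_mem _ he, hxe⟩
  · obtain ⟨e, -, rfl⟩ := Finset.mem_image.1 hu
    have := dist_triangle_left (actX k x) (actX k x') (actX k e)
    have h1 := hx k hk
    have h2 := hx' k hk
    linarith

theorem eventually_sepNum_le_exp [PseudoMetricSpace X] {act : G → X → X} {Fs : ℕ → Finset G}
    (hne : ∀ n, (Fs n).Nonempty) {Z : Set X} {ε a : ℝ}
    (h : ucEntEps act Fs Z ε < ENNReal.ofReal a) :
    ∀ᶠ n in atTop, (sepNum act (Fs n) Z ε : ℝ) ≤ Real.exp (a * (Fs n).card) := by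
  filter_upwards [eventually_lt_of_limsup_lt h] with n hn
  have hpos : (0 : ℝ) < (Fs n).card := by exact_mod_cast (hne n).card_pos
  have h1 := (ENNReal.ofReal_lt_ofReal_iff_of_nonneg
    (div_nonneg (Real.log_natCast_nonneg _) hpos.le)).1 hn
  rw [div_lt_iff₀ hpos] at h1
  rcases Nat.eq_zero_or_pos (sepNum act (Fs n) Z ε) with h0 | h0
  · rw [h0]; simpa using (Real.exp_pos _).le
  · exact (Real.log_le_iff_le_exp (by exact_mod_cast h0)).1 h1.le

/-- By compactness, fiberwise entropy bounds hold at uniformly bounded times. -/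
theorem exists_bounded_times [Group G] [DecidableEq G] [PseudoMetricSpace X]
    [CompactSpace X] [MetricSpace Y] [CompactSpace Y] {actX : G → X → X} {actY : G → Y → Y}
    (hX_cont : ∀ g : G, Continuous (actX g))
    (hY_one : ∀ y, actY 1 y = y) (hY_mul : ∀ g h y, actY (g * h) y = actY g (actY h y))
    (hY_cont : ∀ g : G, Continuous (actY g))
    {π : X → Y} (hπ_cont : Continuous π) {Fs : ℕ → Finset G} (hne : ∀ n, (Fs n).Nonempty)
    {ε a : ℝ} (hε : 0 < ε)
    (ha : ∀ y, ucEntEps actX Fs (π ⁻¹' {y}) (ε / 4) < ENNReal.ofReal a) (M : ℕ) :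
    ∃ δ > 0, ∃ M' : ℕ, ∃ m : Y → ℕ, ∀ y, M ≤ m y ∧ m y ≤ M' ∧
      HasDynCover actX ε (π ⁻¹' dynClosedBall actY (Fs (m y)) y δ) (Fs (m y))
        (a * (Fs (m y)).card) := by
  obtain ⟨κ, -, hκ⟩ := HasDynCover.exists_univ actX (ε := ε / 4) (by positivity)
  have hloc : ∀ y, ∃ n ≥ M, ∃ δ > 0, HasDynCover actX ε
      (π ⁻¹' dynClosedBall actY (Fs n) y (2 * δ)) (Fs n) (a * (Fs n).card) := by
    intro y
    obtain ⟨n, hn, hnM⟩ :=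
      ((eventually_sepNum_le_exp hne (ha y)).and (eventually_ge_atTop M)).exists
    obtain ⟨E, -, hEcard, hE⟩ :=
      ((hκ (Fs n)).subset (subset_univ (π ⁻¹' {y}))).exists_spanning (by positivity)
    exact ⟨n, hnM, exists_hasDynCover_preimage_dynClosedBall hX_cont hY_one hY_mul hY_cont hπ_cont
      hε (hne n) (le_trans (by exact_mod_cast hEcard) hn) hE⟩
  choose n hn δ hδ hcov using hloc
  obtain ⟨t, ht⟩ := (isCompact_univ (X := Y)).elim_finite_subcover
    (fun y => dynBall actY (Fs (n y)) y (δ y)) (fun y => isOpen_dynBall hY_cont _ _ _)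
    (fun y _ => mem_iUnion.2 ⟨y, fun g _ => by simpa using hδ y⟩)
  have hsel : ∀ y, ∃ z ∈ t, y ∈ dynBall actY (Fs (n z)) z (δ z) := fun y => by
    simpa using ht (mem_univ y)
  choose z hzt hz using hsel
  obtain ⟨δ₀, hδ₀, hδ₀pos⟩ : ∃ δ₀, (∀ i ∈ t, δ₀ ≤ δ i) ∧ 0 < δ₀ := by
    have h1 : ∀ᶠ r in 𝓝[>] (0 : ℝ), ∀ i ∈ t, r ≤ δ i :=
      (Filter.eventually_all_finset t).2 fun i _ =>
        (eventually_le_nhds (hδ i)).filter_mono nhdsWithin_le_nhds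
    exact (h1.and self_mem_nhdsWithin).exists
  refine ⟨δ₀, hδ₀pos, t.sup n, fun y => n (z y), fun y =>
    ⟨hn _, Finset.le_sup (hzt y), (hcov (z y)).subset fun x hx g hg => ?_⟩⟩
  have h1 : dist (actY g y) (actY g (π x)) ≤ δ₀ := hx g hg
  have h2 := hz y g hg
  have h3 := hδ₀ _ (hzt y)
  have h4 := dist_triangle (actY g (z y)) (actY g y) (actY g (π x))
  linarith

/-- Separated sets upstairs are counted by separated sets downstairs and covers of preimages of
Bowen balls. -/
theorem sepNum_le_mul_exp [PseudoMetricSpace X] [PseudoMetricSpace Y] {actX : G → X → X}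
    {actY : G → Y → Y} {π : X → Y} {F : Finset G} {ε δ t s : ℝ} (hδ : 0 ≤ δ)
    (hY : HasDynCover actY δ univ F s)
    (hX : ∀ y, HasDynCover actX ε (π ⁻¹' dynClosedBall actY F y δ) F t) (E : Set X) :
    (sepNum actX F E ε : ℝ) ≤ sepNum actY F (π '' E) δ * Real.exp t := by
  classical
  obtain ⟨D, -, hDcard, hD⟩ := (hY.subset (subset_univ (π '' E))).exists_spanning hδ
  have hb : ∀ S : Finset X, ↑S ⊆ E → IsDynSeparated actX F ε ↑S →
      (S.card : ℝ) ≤ sepNum actY F (π '' E) δ * Real.exp t := by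
    intro S hSE hS
    have hsub : S ⊆ D.biUnion fun y => S.filter fun x => π x ∈ dynClosedBall actY F y δ := by
      intro x hx
      obtain ⟨y, hy, hxy⟩ := hD (π x) (mem_image_of_mem _ (hSE hx))
      exact Finset.mem_biUnion.2 ⟨y, hy, Finset.mem_filter.2 ⟨hx, hxy⟩⟩
    calc (S.card : ℝ)
        ≤ ∑ y ∈ D, ((S.filter fun x => π x ∈ dynClosedBall actY F y δ).card : ℝ) := by
          exact_mod_cast (Finset.card_le_card hsub).trans Finset.card_biUnion_le
      _ ≤ ∑ _y ∈ D, Real.exp t := by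
          refine Finset.sum_le_sum fun y _ => (hX y).card_le_of_isDynSeparated ?_ ?_
          · intro x hx
            exact (Finset.mem_filter.1 hx).2
          · intro x hx x' hx' hne
            exact hS x (Finset.mem_filter.1 hx).1 x' (Finset.mem_filter.1 hx').1 hne
      _ = D.card * Real.exp t := by simp
      _ ≤ _ := by gcongr
  have : sepNum actX F E ε ≤ ⌊sepNum actY F (π '' E) δ * Real.exp t⌋₊ := by
    refine csSup_le' fun k hk => ?_
    obtain ⟨S, hSE, hS, rfl⟩ := hk
    exact Nat.le_floor (hb S hSE hS)
  exact (Nat.le_floor_iff (by positivity)).1 this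

theorem ucEntEps_le_add_of_sepNum_le [PseudoMetricSpace X] [PseudoMetricSpace Y]
    {actX : G → X → X} {actY : G → Y → Y} {Fs : ℕ → Finset G} (hne : ∀ n, (Fs n).Nonempty)
    {E : Set X} {D : Set Y} {ε δ b : ℝ} (hb : 0 ≤ b)
    (h : ∀ᶠ n in atTop, (sepNum actX (Fs n) E ε : ℝ) ≤
      sepNum actY (Fs n) D δ * Real.exp (b * (Fs n).card)) :
    ucEntEps actX Fs E ε ≤ ucEntEps actY Fs D δ + ENNReal.ofReal b := by
  rw [ucEntEps, ucEntEps, ← limsup_add_const _ _ _ (by isBoundedDefault) (by isBoundedDefault)]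
  refine limsup_le_limsup ?_
  filter_upwards [h] with n hn
  have hpos : (0 : ℝ) < (Fs n).card := by exact_mod_cast (hne n).card_pos
  rw [← ENNReal.ofReal_add (div_nonneg (Real.log_natCast_nonneg _) hpos.le) hb]
  refine ENNReal.ofReal_le_ofReal ?_
  rw [div_add' _ _ _ hpos.ne']
  gcongr
  rcases Nat.eq_zero_or_pos (sepNum actX (Fs n) E ε) with h0 | h0
  · rw [h0, Nat.cast_zero, Real.log_zero]
    exact add_nonneg (Real.log_natCast_nonneg _) (by positivity)
  · have h0' : (0 : ℝ) < sepNum actX (Fs n) E ε := by exact_mod_cast h0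
    have h1 : (sepNum actY (Fs n) D δ : ℝ) ≠ 0 := fun h1 => by
      rw [h1, zero_mul] at hn
      exact hn.not_gt h0'
    calc _ ≤ Real.log (sepNum actY (Fs n) D δ * Real.exp (b * (Fs n).card)) :=
          Real.log_le_log h0' hn
      _ = _ := by rw [Real.log_mul h1 (Real.exp_pos _).ne', Real.log_exp]

theorem upper_capacity_entropy_factor_inequality
    [Group G] [Countable G] [Infinite G] [DecidableEq G]
    [MetricSpace X] [CompactSpace X] [MeasurableSpace X] [BorelSpace X]
    [MetricSpace Y] [CompactSpace Y] [MeasurableSpace Y] [BorelSpace Y]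
    (actX : G → X → X) (actY : G → Y → Y)
    (hX_one : ∀ x, actX 1 x = x) (hX_mul : ∀ g h x, actX (g * h) x = actX g (actX h x))
    (hX_cont : ∀ g : G, Continuous (actX g))
    (hY_one : ∀ y, actY 1 y = y) (hY_mul : ∀ g h y, actY (g * h) y = actY g (actY h y))
    (hY_cont : ∀ g : G, Continuous (actY g))
    (π : X → Y) (hπ_cont : Continuous π) (hπ_surj : Function.Surjective π)
    (hπ_equiv : ∀ g x, π (actX g x) = actY g (π x))
    (Fs : ℕ → Finset G) (hFol : Folner Fs) (htemp : Tempered Fs) (hgrow : GrowthCond Fs)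
    (E : Set X) :
    ucEnt actX Fs E ≤ ucEnt actY Fs (π '' E) + ⨆ y : Y, ucEnt actX Fs (π ⁻¹' {y}) := by
  refine iSup₂_le fun ε hε => ?_
  rcases eq_or_ne (⨆ y : Y, ucEnt actX Fs (π ⁻¹' {y})) ⊤ with htop | htop
  · simp [htop]
  refine ENNReal.le_of_forall_pos_le_add fun η hη _ => ?_
  have hη' : (0 : ℝ) < η := hη
  set S := ⨆ y : Y, ucEnt actX Fs (π ⁻¹' {y}) with hS
  set a : ℝ := S.toReal + η / 2 with ha
  have ha0 : 0 < a := by positivity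
  have hfib : ∀ y, ucEntEps actX Fs (π ⁻¹' {y}) (ε / 4) < ENNReal.ofReal a := fun y => by
    have h1 : ucEntEps actX Fs (π ⁻¹' {y}) (ε / 4) ≤ S :=
      (le_iSup₂ (f := fun (r : ℝ) (_ : 0 < r) => ucEntEps actX Fs (π ⁻¹' {y}) r) (ε / 4)
        (by positivity)).trans (le_iSup (fun y => ucEnt actX Fs (π ⁻¹' {y})) y)
    exact h1.trans_lt ((ENNReal.lt_ofReal_iff_toReal_lt htop).2 (by linarith))
  obtain ⟨κ, hκ0, hκ⟩ := HasDynCover.exists_univ actX hε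
  obtain ⟨δ, hδ, N, hN⟩ :=
    (isOrbitCost_hasDynCover hX_mul hY_mul hπ_equiv hκ).exists_uniform_bound hFol htemp hκ0 ha0
      (exists_bounded_times hX_cont hY_one hY_mul hY_cont hπ_cont hFol.1 hε hfib)
      (half_pos hη')
  obtain ⟨κ', -, hκ'⟩ := HasDynCover.exists_univ actY hδ
  have hle : ucEntEps actX Fs E ε ≤ ucEntEps actY Fs (π '' E) δ + ENNReal.ofReal (a + η / 2) := by
    refine ucEntEps_le_add_of_sepNum_le hFol.1 (by positivity) ?_
    filter_upwards [eventually_ge_atTop N] with n hn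
    exact sepNum_le_mul_exp hδ.le (hκ' (Fs n)) (hN n hn) E
  refine hle.trans ?_
  have hc : ENNReal.ofReal (a + η / 2) = S + η := by
    rw [ha, add_assoc, add_halves, ENNReal.ofReal_add ENNReal.toReal_nonneg hη'.le,
      ENNReal.ofReal_toReal htop, ENNReal.ofReal_coe_nnreal]
  rw [hc, add_assoc]
  gcongr
  exact le_iSup₂ (f := fun (r : ℝ) (_ : 0 < r) => ucEntEps actY Fs (π '' E) r) δ hδ

end AmenablePacking
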